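/- arXiv:1511.03305 — 3 statements merged into one kernel-verified Lean document; each statement's English description precedes it below -/
import Mathlib

section
/- For every γ > 0, the smoothed dual component d¹_γ is concave and differentiable on ℝ^n, its gradient is ∇d¹_γ(λ) = −A·u*_γ(λ), where u*_γ(λ) is the unique minimizer of u ↦ g(u) − ⟨λ,Au⟩ + γ·p_U(u) over U, and ∇d¹_γ is Lipschitz continuous with Lipschitz constant L^γ_{d¹} := ‖A‖²/(γ·μ_p). -/
open scoped RealInnerProductSpace

section

variable {E F : Type*} [NormedAddCommGroup E] [InnerProductSpace ℝ E]
  [NormedAddCommGroup F] [InnerProductSpace ℝ F]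

/-- A strongly convex function grows at least quadratically away from a minimizer. -/
theorem StrongConvexOn.add_sq_norm_sub_le_of_isMinOn {s : Set E} {m : ℝ} {f : E → ℝ}
    (hf : StrongConvexOn s m f) {x y : E} (hx : x ∈ s) (hmin : IsMinOn f s x) (hy : y ∈ s) :
    f x + m / 2 * ‖x - y‖ ^ 2 ≤ f y := by
  have key : ∀ t ∈ Set.Ioo (0 : ℝ) 1, f x + (1 - t) * (m / 2 * ‖x - y‖ ^ 2) ≤ f y := by
    rintro t ⟨h0, h1⟩
    have hconv := hf.2 hx hy (sub_nonneg.2 h1.le) h0.le (sub_add_cancel 1 t)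
    have hle := hmin (hf.1 hx hy (sub_nonneg.2 h1.le) h0.le (sub_add_cancel 1 t))
    simp only [smul_eq_mul, Set.mem_ofPred_eq] at hconv hle
    refine le_of_mul_le_mul_left ?_ h0
    linarith
  have hlim : Filter.Tendsto (fun t : ℝ => f x + (1 - t) * (m / 2 * ‖x - y‖ ^ 2))
      (nhdsWithin 0 (Set.Ioi 0)) (nhds (f x + m / 2 * ‖x - y‖ ^ 2)) := by
    refine tendsto_nhdsWithin_of_tendsto_nhds (Continuous.tendsto' (by fun_prop) _ _ (by simp))
  exact le_of_tendsto hlim (Filter.eventually_of_mem (Ioo_mem_nhdsGT one_pos) key)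

/-- The minimizer of a strongly convex function under a linear perturbation `⟪l, A ·⟫` is
Lipschitz in `l`. -/
theorem StrongConvexOn.norm_sub_le_of_isMinOn_sub_inner {s : Set E} {m : ℝ} {f : E → ℝ}
    (hf : StrongConvexOn s m f) (hm : 0 < m) (A : E →L[ℝ] F) {l₁ l₂ : F} {x₁ x₂ : E}
    (hx₁ : x₁ ∈ s) (hx₂ : x₂ ∈ s) (h₁ : IsMinOn (fun u => f u - ⟪l₁, A u⟫) s x₁)
    (h₂ : IsMinOn (fun u => f u - ⟪l₂, A u⟫) s x₂) :
    ‖x₁ - x₂‖ ≤ ‖A‖ / m * ‖l₁ - l₂‖ := by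
  have hpert : ∀ l : F, StrongConvexOn s m (fun u => f u - ⟪l, A u⟫) := by
    intro l
    have hlin : ConvexOn ℝ s (fun u => -⟪l, A u⟫) :=
      (-((innerSL ℝ l).comp A).toLinearMap).convexOn hf.1
    simpa [StrongConvexOn, sub_eq_add_neg, Pi.add_def] using
      UniformConvexOn.add hf hlin.uniformConvexOn_zero
  have g₁ := (hpert l₁).add_sq_norm_sub_le_of_isMinOn hx₁ h₁ hx₂
  have g₂ := (hpert l₂).add_sq_norm_sub_le_of_isMinOn hx₂ h₂ hx₁
  rw [norm_sub_rev x₂ x₁] at g₂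
  have hinner : m * ‖x₁ - x₂‖ ^ 2 ≤ ⟪l₁ - l₂, A (x₁ - x₂)⟫ := by
    simp only [map_sub, inner_sub_left, inner_sub_right]
    linarith
  have hbound : ⟪l₁ - l₂, A (x₁ - x₂)⟫ ≤ ‖l₁ - l₂‖ * (‖A‖ * ‖x₁ - x₂‖) :=
    (real_inner_le_norm _ _).trans (by gcongr; exact A.le_opNorm _)
  rw [div_mul_eq_mul_div, le_div_iff₀ hm]
  rcases (norm_nonneg (x₁ - x₂)).eq_or_lt with h | h
  · rw [← h, zero_mul]; positivity
  · refine le_of_mul_le_mul_right ?_ h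
    linarith

/-- A function with a supergradient at every point is concave. -/
theorem concaveOn_univ_of_forall_le_add_inner {f : F → ℝ} {G : F → F}
    (hf : ∀ x y, f y ≤ f x + ⟪G x, y - x⟫) : ConcaveOn ℝ Set.univ f := by
  refine ⟨convex_univ, fun x _ y _ a b ha hb hab => ?_⟩
  set z := a • x + b • y with hz
  have hzero : a * ⟪G z, x - z⟫ + b * ⟪G z, y - z⟫ = 0 := by
    rw [← real_inner_smul_right, ← real_inner_smul_right, ← inner_add_right]
    have : a • (x - z) + b • (y - z) = 0 := by
      rw [smul_sub, smul_sub, sub_add_sub_comm, ← add_smul, hab, one_smul, ← hz, sub_self]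
    rw [this, inner_zero_right]
  have hx := mul_le_mul_of_nonneg_left (hf z x) ha
  have hy := mul_le_mul_of_nonneg_left (hf z y) hb
  have hfz : a * f z + b * f z = f z := by rw [← add_mul, hab, one_mul]
  simp only [smul_eq_mul]
  linarith

/-- A Lipschitz selection of supergradients is a gradient. -/
theorem hasGradientAt_of_forall_le_add_inner [CompleteSpace F] {f : F → ℝ} {G : F → F} {K : ℝ}
    (hf : ∀ x y, f y ≤ f x + ⟪G x, y - x⟫) (hG : ∀ x y, ‖G x - G y‖ ≤ K * ‖x - y‖) (x : F) :
    HasGradientAt f (G x) x := by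
  rw [hasGradientAt_iff_isLittleO]
  have hO : (fun y => f y - f x - ⟪G x, y - x⟫) =O[nhds x] fun y => ‖y - x‖ ^ 2 := by
    refine Asymptotics.IsBigO.of_bound K (Filter.Eventually.of_forall fun y => ?_)
    have hle := hf x y
    have hge := hf y x
    have hinner : ⟪G x - G y, y - x⟫ ≤ K * ‖y - x‖ ^ 2 := calc
      ⟪G x - G y, y - x⟫ ≤ ‖G x - G y‖ * ‖y - x‖ := real_inner_le_norm _ _
      _ ≤ K * ‖x - y‖ * ‖y - x‖ := by gcongr; exact hG x y
      _ = K * ‖y - x‖ ^ 2 := by rw [norm_sub_rev x y]; ring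
    rw [← neg_sub y x, inner_neg_right] at hge
    rw [inner_sub_left] at hinner
    rw [Real.norm_of_nonpos (by linarith), Real.norm_of_nonneg (by positivity)]
    linarith
  exact hO.trans_isLittleO (Asymptotics.isLittleO_norm_right.1
    ((Asymptotics.isLittleO_pow_sub_sub x one_lt_two).norm_right))

end

/-- for every `γ > 0`, the smoothed dual component `d¹_γ` is concave and
differentiable, with gradient `∇d¹_γ(λ) = −A·u*_γ(λ)` (where `u*_γ(λ)` is the unique
minimizer), and the gradient is Lipschitz with constant `L^γ_{d¹} = ‖A‖²/(γ·μ_p)`. -/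
theorem smoothed_dual_component_gradient {n p1 : ℕ}
    (g pU : EuclideanSpace ℝ (Fin p1) → ℝ)
    (U : Set (EuclideanSpace ℝ (Fin p1)))
    (hUne : U.Nonempty) (hUcl : IsClosed U) (hUcv : Convex ℝ U)
    (hgcv : ConvexOn ℝ U g) (hglsc : LowerSemicontinuousOn g U)
    (A : EuclideanSpace ℝ (Fin p1) →L[ℝ] EuclideanSpace ℝ (Fin n))
    (μp : ℝ) (hμp : 0 < μp)
    (hpU : StrongConvexOn U μp pU) (hpUc : Continuous pU)
    (γ : ℝ) (hγ : 0 < γ)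
    -- `u*_γ(λ)` is the unique minimizer of `u ↦ g(u) − ⟨λ, Au⟩ + γ·p_U(u)` over `U`
    (ustar : EuclideanSpace ℝ (Fin n) → EuclideanSpace ℝ (Fin p1))
    (hustar : ∀ lam, ustar lam ∈ U ∧
      (∀ u ∈ U, g (ustar lam) - ⟪lam, A (ustar lam)⟫ + γ * pU (ustar lam)
          ≤ g u - ⟪lam, A u⟫ + γ * pU u) ∧
      (∀ u ∈ U, (∀ u' ∈ U, g u - ⟪lam, A u⟫ + γ * pU u
          ≤ g u' - ⟪lam, A u'⟫ + γ * pU u') → u = ustar lam))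
    -- `d¹_γ(λ)` is the minimum value
    (d1γ : EuclideanSpace ℝ (Fin n) → ℝ)
    (hd1γ : ∀ lam, d1γ lam = g (ustar lam) - ⟪lam, A (ustar lam)⟫ + γ * pU (ustar lam)) :
    ConcaveOn ℝ Set.univ d1γ ∧
    (∀ lam, HasGradientAt d1γ (-(A (ustar lam))) lam) ∧
    (∀ lam₁ lam₂, ‖(-(A (ustar lam₁))) - (-(A (ustar lam₂)))‖
        ≤ ‖A‖ ^ 2 / (γ * μp) * ‖lam₁ - lam₂‖) := by
  have hmin : ∀ lam, IsMinOn (fun u => (g u + γ * pU u) - ⟪lam, A u⟫) U (ustar lam) :=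
    fun lam u hu => by
      have := (hustar lam).2.1 u hu
      simp only [Set.mem_ofPred_eq]
      linarith
  have hstrong : StrongConvexOn U (γ * μp) (fun u => g u + γ * pU u) := by
    refine ⟨hUcv, fun x hx y hy a b ha hb hab => ?_⟩
    have hg := hgcv.2 hx hy ha hb hab
    have hp := mul_le_mul_of_nonneg_left (hpU.2 hx hy ha hb hab) hγ.le
    simp only [smul_eq_mul] at hg hp ⊢
    linarith
  have hsuper : ∀ l₁ l₂, d1γ l₂ ≤ d1γ l₁ + ⟪-(A (ustar l₁)), l₂ - l₁⟫ := by
    intro l₁ l₂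
    have := (hustar l₂).2.1 (ustar l₁) (hustar l₁).1
    rw [hd1γ, hd1γ, inner_neg_left, real_inner_comm (l₂ - l₁), inner_sub_left]
    linarith
  have hLip : ∀ l₁ l₂, ‖(-(A (ustar l₁))) - (-(A (ustar l₂)))‖
      ≤ ‖A‖ ^ 2 / (γ * μp) * ‖l₁ - l₂‖ := by
    intro l₁ l₂
    rw [← neg_sub', norm_neg, ← map_sub]
    calc ‖A (ustar l₁ - ustar l₂)‖ ≤ ‖A‖ * ‖ustar l₁ - ustar l₂‖ := A.le_opNorm _
      _ ≤ ‖A‖ * (‖A‖ / (γ * μp) * ‖l₁ - l₂‖) := by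
        gcongr
        exact hstrong.norm_sub_le_of_isMinOn_sub_inner (mul_pos hγ hμp) A
          (hustar l₁).1 (hustar l₂).1 (hmin l₁) (hmin l₂)
      _ = ‖A‖ ^ 2 / (γ * μp) * ‖l₁ - l₂‖ := by ring
  exact ⟨concaveOn_univ_of_forall_le_add_inner hsuper,
    hasGradientAt_of_forall_le_add_inner hsuper hLip, hLip⟩
end

section
/- For every γ > 0 and all λ, λ̃ ∈ ℝ^n, the smoothed dual component satisfies the quadratic lower bound d¹_γ(λ) + ⟨∇d¹_γ(λ), λ̃ − λ⟩ − (L^γ_{d¹}/2)·‖λ̃ − λ‖² ≤ d¹_γ(λ̃), where L^γ_{d¹} := ‖A‖²/(γ·μ_p). -/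
open scoped RealInnerProductSpace

section StrongConvexity

variable {E : Type*} [NormedAddCommGroup E] [NormedSpace ℝ E] {s : Set E} {f : E → ℝ} {m : ℝ}

lemma StrongConvexOn.const_mul (hf : StrongConvexOn s m f) {c : ℝ} (hc : 0 ≤ c) :
    StrongConvexOn s (c * m) fun x ↦ c * f x := by
  refine ⟨hf.1, fun x hx y hy a b ha hb hab ↦ ?_⟩
  have h := mul_le_mul_of_nonneg_left (hf.2 hx hy ha hb hab) hc
  simp only [smul_eq_mul] at h ⊢
  linarith

lemma ConvexOn.add_strongConvexOn {g : E → ℝ} (hg : ConvexOn ℝ s g)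
    (hf : StrongConvexOn s m f) : StrongConvexOn s m fun x ↦ g x + f x := by
  refine ⟨hf.1, fun x hx y hy a b ha hb hab ↦ ?_⟩
  have h₁ := hg.2 hx hy ha hb hab
  have h₂ := hf.2 hx hy ha hb hab
  simp only [smul_eq_mul] at h₁ h₂ ⊢
  linarith

/-- A strongly convex function grows at least quadratically away from a minimizer. -/
lemma StrongConvexOn.add_sq_le_of_isMinOn (hf : StrongConvexOn s m f) {x y : E}
    (hx : x ∈ s) (hy : y ∈ s) (hmin : IsMinOn f s x) :
    f x + m / 2 * ‖y - x‖ ^ 2 ≤ f y := by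
  have hle : ∀ t ∈ Set.Ioo (0 : ℝ) 1, f x + (1 - t) * (m / 2 * ‖y - x‖ ^ 2) ≤ f y := by
    rintro t ⟨ht₀, ht₁⟩
    have hmem := hf.1 hy hx ht₀.le (sub_nonneg.2 ht₁.le) (add_sub_cancel t 1)
    have h := (isMinOn_iff.1 hmin _ hmem).trans
      (hf.2 hy hx ht₀.le (sub_nonneg.2 ht₁.le) (add_sub_cancel t 1))
    simp only [smul_eq_mul] at h
    refine le_of_mul_le_mul_left ?_ ht₀
    linarith
  have hlim : Filter.Tendsto (fun t : ℝ ↦ f x + (1 - t) * (m / 2 * ‖y - x‖ ^ 2))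
      (nhdsWithin 0 (Set.Ioi 0)) (nhds (f x + (1 - 0) * (m / 2 * ‖y - x‖ ^ 2))) :=
    (Continuous.tendsto (by fun_prop) 0).mono_left nhdsWithin_le_nhds
  rw [sub_zero, one_mul] at hlim
  exact le_of_tendsto hlim
    (Filter.eventually_of_mem (Ioo_mem_nhdsGT one_pos) hle)

end StrongConvexity

/-- the smoothed dual component satisfies the quadratic lower bound
`d¹_γ(λ) + ⟨∇d¹_γ(λ), λ̃ − λ⟩ − (L^γ_{d¹}/2)·‖λ̃ − λ‖² ≤ d¹_γ(λ̃)` for all `λ, λ̃`,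
where `∇d¹_γ(λ) = −A·u*_γ(λ)` and `L^γ_{d¹} = ‖A‖²/(γ·μ_p)`. -/
theorem smoothed_dual_component_quadratic_lower_bound {n p1 : ℕ}
    (g pU : EuclideanSpace ℝ (Fin p1) → ℝ)
    (U : Set (EuclideanSpace ℝ (Fin p1)))
    (hUne : U.Nonempty) (hUcl : IsClosed U) (hUcv : Convex ℝ U)
    (hgcv : ConvexOn ℝ U g) (hglsc : LowerSemicontinuousOn g U)
    (A : EuclideanSpace ℝ (Fin p1) →L[ℝ] EuclideanSpace ℝ (Fin n))
    (μp : ℝ) (hμp : 0 < μp)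
    (hpU : StrongConvexOn U μp pU) (hpUc : Continuous pU)
    (γ : ℝ) (hγ : 0 < γ)
    -- `u*_γ(λ)` is the unique minimizer of `u ↦ g(u) − ⟨λ, Au⟩ + γ·p_U(u)` over `U`
    (ustar : EuclideanSpace ℝ (Fin n) → EuclideanSpace ℝ (Fin p1))
    (hustar : ∀ lam, ustar lam ∈ U ∧
      (∀ u ∈ U, g (ustar lam) - ⟪lam, A (ustar lam)⟫ + γ * pU (ustar lam)
          ≤ g u - ⟪lam, A u⟫ + γ * pU u) ∧
      (∀ u ∈ U, (∀ u' ∈ U, g u - ⟪lam, A u⟫ + γ * pU u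
          ≤ g u' - ⟪lam, A u'⟫ + γ * pU u') → u = ustar lam))
    (d1γ : EuclideanSpace ℝ (Fin n) → ℝ)
    (hd1γ : ∀ lam, d1γ lam = g (ustar lam) - ⟪lam, A (ustar lam)⟫ + γ * pU (ustar lam)) :
    ∀ lam lamt : EuclideanSpace ℝ (Fin n),
      d1γ lam + ⟪-(A (ustar lam)), lamt - lam⟫
        - ‖A‖ ^ 2 / (γ * μp) / 2 * ‖lamt - lam‖ ^ 2 ≤ d1γ lamt := by
  intro lam lamt
  obtain ⟨hu, hmin, -⟩ := hustar lam
  obtain ⟨hv, -, -⟩ := hustar lamt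
  rw [hd1γ lam, hd1γ lamt]
  set u := ustar lam
  set v := ustar lamt
  have hlin : ConvexOn ℝ U fun w ↦ -⟪lam, A w⟫ := by
    refine ⟨hUcv, fun x _ y _ a b _ _ _ ↦ le_of_eq ?_⟩
    simp only [map_add, map_smul, inner_add_right, inner_smul_right, smul_eq_mul]
    ring
  have hgrowth := ((hgcv.add hlin).add_strongConvexOn (hpU.const_mul hγ.le)).add_sq_le_of_isMinOn
    hu hv (isMinOn_iff.2 fun w hw ↦ by simpa [sub_eq_add_neg] using hmin w hw)
  simp only [Pi.add_apply] at hgrowth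
  have hc : 0 < γ * μp := mul_pos hγ hμp
  have hcross : ⟪lamt - lam, A v⟫ - ⟪lamt - lam, A u⟫
      ≤ ‖lamt - lam‖ * (‖A‖ * ‖v - u‖) := by
    rw [← inner_sub_right, ← map_sub]
    exact (real_inner_le_norm _ _).trans
      (mul_le_mul_of_nonneg_left (A.le_opNorm _) (norm_nonneg _))
  have hyoung : ‖lamt - lam‖ * (‖A‖ * ‖v - u‖) ≤
      ‖A‖ ^ 2 / (γ * μp) / 2 * ‖lamt - lam‖ ^ 2 + γ * μp / 2 * ‖v - u‖ ^ 2 := by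
    have h : 0 ≤ (‖A‖ * ‖lamt - lam‖ - γ * μp * ‖v - u‖) ^ 2 / (2 * (γ * μp)) := by positivity
    have heq : (‖A‖ * ‖lamt - lam‖ - γ * μp * ‖v - u‖) ^ 2 / (2 * (γ * μp)) =
        ‖A‖ ^ 2 / (γ * μp) / 2 * ‖lamt - lam‖ ^ 2 + γ * μp / 2 * ‖v - u‖ ^ 2
          - ‖lamt - lam‖ * (‖A‖ * ‖v - u‖) := by
      field_simp
      ring
    linarith
  rw [inner_neg_left, real_inner_comm (lamt - lam) (A u)]
  simp only [inner_sub_left] at hcross ⊢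
  linarith
end

section
/- Let r, λ^0, λ* ∈ ℝ^n, S > 0, and D ≥ 0. If ⟨r, λ* − λ⟩ − (1/(2S))‖λ^0 − λ‖² − D ≤ 0 holds for every λ ∈ ℝ^n, then ‖r‖ ≤ ( ‖λ^0 − λ*‖ + √( ‖λ^0 − λ*‖² + 2SD ) ) / S; in particular ‖r‖ ≤ 2‖λ^0 − λ*‖/S + √(2D/S). -/
open scoped RealInnerProductSpace

/-- converting the dual-gap inequality, valid for all multipliers `λ`,
into a bound on the norm of the residual `r`. -/
theorem feasibility_gap_bound_from_multiplier_inequality {n : ℕ}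
    (r lam0 lamstar : EuclideanSpace ℝ (Fin n)) (S D : ℝ)
    (hS : 0 < S) (hD : 0 ≤ D)
    (hineq : ∀ lam : EuclideanSpace ℝ (Fin n),
      ⟪r, lamstar - lam⟫ - 1 / (2 * S) * ‖lam0 - lam‖ ^ 2 - D ≤ 0) :
    ‖r‖ ≤ (‖lam0 - lamstar‖ + Real.sqrt (‖lam0 - lamstar‖ ^ 2 + 2 * S * D)) / S ∧
      ‖r‖ ≤ 2 * ‖lam0 - lamstar‖ / S + Real.sqrt (2 * D / S) := by
  have hbound : ‖r‖ ≤ (‖lam0 - lamstar‖ + Real.sqrt (‖lam0 - lamstar‖ ^ 2 + 2 * S * D)) / S := by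
    -- the left-hand side of `hineq` is maximized at `lam0 - S • r`
    have h := hineq (lam0 - S • r)
    have hsplit : lamstar - (lam0 - S • r) = S • r - (lam0 - lamstar) := by abel
    rw [hsplit, sub_sub_cancel, inner_sub_right, real_inner_smul_right,
      real_inner_self_eq_norm_sq, norm_smul, Real.norm_of_nonneg hS.le] at h
    have hcs := real_inner_le_norm r (lam0 - lamstar)
    have hhalf : 1 / (2 * S) * (S * ‖r‖) ^ 2 = S * ‖r‖ ^ 2 / 2 := by field_simp
    rw [hhalf] at h
    have hquad : S * ‖r‖ ^ 2 / 2 - ‖r‖ * ‖lam0 - lamstar‖ - D ≤ 0 := by linarith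
    have hsq : (S * ‖r‖ - ‖lam0 - lamstar‖) ^ 2 ≤ ‖lam0 - lamstar‖ ^ 2 + 2 * S * D := by
      nlinarith [mul_nonpos_of_nonneg_of_nonpos hS.le hquad]
    have hsqrt := Real.le_sqrt_of_sq_le hsq
    rw [le_div_iff₀ hS]
    linarith
  refine ⟨hbound, hbound.trans ?_⟩
  have ht : Real.sqrt (2 * D / S) ^ 2 = 2 * D / S := Real.sq_sqrt (by positivity)
  have hSD : 2 * S * D = (S * Real.sqrt (2 * D / S)) ^ 2 := by
    rw [mul_pow, ht]
    field_simp
  have hsqrt : Real.sqrt (‖lam0 - lamstar‖ ^ 2 + 2 * S * D) ≤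
      ‖lam0 - lamstar‖ + S * Real.sqrt (2 * D / S) := by
    rw [hSD]
    have hcross : 0 ≤ ‖lam0 - lamstar‖ * (S * Real.sqrt (2 * D / S)) := by positivity
    refine Real.sqrt_le_iff.mpr ⟨by positivity, ?_⟩
    rw [add_sq]
    linarith
  rw [div_add' _ _ _ hS.ne']
  exact div_le_div_of_nonneg_right (by linarith) hS.le
end
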